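/- Let α ≥ 0 and let x ∈ (0,1) be irrational with regular continued fraction convergent denominators (Q_n)_{n≥0}. If Σ_{n=1}^{∞} ( log(Q_{n+1}) / Q_{n−1}^{α} + Q_{n+1} (log Q_{n+1})² / Q_n^{1+α} ) < ∞, then the series Σ_{j=0}^{∞} (Π_{ℓ=0}^{j−1} |T^ℓ(x)|)^{α} · log(1/|T^j(x)|) converges (empty product equal to 1 for j = 0). -/

import Mathlib

open Complex Filter Finset

noncomputable section

/-- `ρ = e^{iπ/4}`. -/
def ρ : ℂ := Complex.exp (Real.pi * Complex.I / 4)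

/-- Partial sum `F_{s,n}(x,t) = Σ_{k=1}^{n} e^{iπk²x + 2πikt}/k^s`. -/
def Fpart (s : ℝ) (n : ℕ) (x t : ℝ) : ℂ :=
  ∑ k ∈ Finset.Icc 1 n,
    Complex.exp (Real.pi * Complex.I * (k : ℂ) ^ 2 * (x : ℂ)
        + 2 * Real.pi * Complex.I * (k : ℂ) * (t : ℂ)) / (k : ℂ) ^ (s : ℂ)

/-- The function `I_s(x,t)` (for `x > 0`). -/
def Ifun (s x t : ℝ) : ℂ :=
  (∫ u : ℝ, ρ *
      (Complex.exp (Real.pi * Complex.I * ((1 : ℂ) / 2 + ρ * (u : ℂ)) ^ 2 * (x : ℂ)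
            + 2 * Real.pi * Complex.I * ((1 : ℂ) / 2 + ρ * (u : ℂ)) * (Int.fract t : ℝ)) /
        (((1 : ℂ) / 2 + ρ * (u : ℂ)) ^ (s : ℂ) *
          (1 - Complex.exp (2 * Real.pi * Complex.I * ((1 : ℂ) / 2 + ρ * (u : ℂ)))))))
  + ρ * (x : ℂ) ^ (s : ℂ) *
    ∫ u : ℝ, (Real.exp (-(Real.pi * x * u ^ 2)) : ℝ) *
      ∑' k : ℕ, Complex.exp (-(Real.pi * Complex.I * (((k : ℂ) + 1) - (Int.fract t : ℝ)) ^ 2 / (x : ℂ))) *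
        (((ρ * (x : ℂ) * (u : ℂ) + ((k : ℂ) + 1) - (Int.fract t : ℝ)) ^ (s : ℂ))⁻¹
          - (((k : ℂ) + 1) ^ (s : ℂ))⁻¹)

/-- `Ω_s(x,t)`. -/
def Omega (s x t : ℝ) : ℂ :=
  if 0 < x then Ifun s x t else (starRingEnd ℂ) (Ifun s (-x) (-t))

/-- `Ω_s(x) = Ω_s(x,0)`. -/
def Omega0 (s x : ℝ) : ℂ := Omega s x 0

/-- The map `T(x) = -1/x mod 2`, valued in `(-1,1]`. -/
def Tmap (x : ℝ) : ℝ := -1 / x - 2 * ⌈((-1 / x) - 1) / 2⌉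

/-- Denominator `Q_n` of the `n`-th convergent of the regular continued fraction of `x`. -/
def Qden (x : ℝ) (n : ℕ) : ℝ := (GenContFract.of x).dens n

end

/-- If increments of a monotone sequence are confined to windows `[u n, v n]` and weighted by `c n`,
their total is controlled by `∑ c n * (v n - u n)`. -/
theorem summable_of_increment_windows {c u v l t : ℕ → ℝ} (hc : ∀ n, 0 ≤ c n)
    (huv : ∀ n, u n ≤ v n) (hl : Monotone l) (ht : ∀ j, 0 ≤ t j)
    (hwin : ∀ j, ∃ n, u n ≤ l j ∧ l (j + 1) ≤ v n ∧ t j ≤ c n * (l (j + 1) - l j))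
    (hs : Summable fun n => c n * (v n - u n)) : Summable t := by
  set clamp : ℕ → ℝ → ℝ := fun n y => max (u n) (min y (v n)) with hclamp
  have hmono : ∀ n, Monotone (clamp n) := fun n y z hyz =>
    max_le_max le_rfl (min_le_min hyz le_rfl)
  have hlow : ∀ n y, u n ≤ clamp n y := fun n y => le_max_left _ _
  have hupp : ∀ n y, clamp n y ≤ v n := fun n y => max_le (huv n) (min_le_right _ _)
  have hΦ : ∀ y, Summable fun n => c n * (clamp n y - u n) := fun y =>
    Summable.of_nonneg_of_le (fun n => mul_nonneg (hc n) (sub_nonneg.2 (hlow n y)))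
      (fun n => mul_le_mul_of_nonneg_left (sub_le_sub_right (hupp n y) _) (hc n)) hs
  set Φ : ℝ → ℝ := fun y => ∑' n, c n * (clamp n y - u n) with hΦdef
  have hstep : ∀ j, t j ≤ Φ (l (j + 1)) - Φ (l j) := by
    intro j
    obtain ⟨n, h1, h2, h3⟩ := hwin j
    have hlj := hl (Nat.le_succ j)
    have e1 : clamp n (l (j + 1)) = l (j + 1) := by
      simp only [hclamp]
      rw [min_eq_left h2, max_eq_right (h1.trans hlj)]
    have e2 : clamp n (l j) = l j := by
      simp only [hclamp]
      rw [min_eq_left (hlj.trans h2), max_eq_right h1]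
    have hsub := (hΦ (l (j + 1))).sub (hΦ (l j))
    have hle := hsub.le_tsum n (fun i _ => by
      have := mul_le_mul_of_nonneg_left (hmono i hlj) (hc i)
      simp only [Nat.succ_eq_add_one] at this
      linarith)
    rw [e1, e2] at hle
    calc t j ≤ c n * (l (j + 1) - l j) := h3
      _ = c n * (l (j + 1) - u n) - c n * (l j - u n) := by ring
      _ ≤ _ := hle
      _ = _ := (hΦ (l (j + 1))).tsum_sub (hΦ (l j))
  refine summable_of_sum_range_le (c := ∑' n, c n * (v n - u n)) ht fun N => ?_
  calc ∑ j ∈ Finset.range N, t j ≤ ∑ j ∈ Finset.range N, (Φ (l (j + 1)) - Φ (l j)) :=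
        Finset.sum_le_sum fun j _ => hstep j
    _ = Φ (l N) - Φ (l 0) := Finset.sum_range_sub (fun j => Φ (l j)) N
    _ ≤ Φ (l N) := sub_le_self _ (tsum_nonneg fun n =>
        mul_nonneg (hc n) (sub_nonneg.2 (hlow n _)))
    _ ≤ _ := (hΦ (l N)).tsum_le_tsum
        (fun n => mul_le_mul_of_nonneg_left (sub_le_sub_right (hupp n _) _) (hc n)) hs

/-- Interlacing of the remainders `p` of the Euclidean algorithm with even quotients and the
remainders `D` of the ordinary Euclidean algorithm. -/
theorem even_remainders_interlace {D p : ℕ → ℝ} {a : ℕ → ℤ} (hD : ∀ n, 0 < D n)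
    (hanti : ∀ n, D (n + 1) < D n) (ha : ∀ n, 1 ≤ a n)
    (hrec : ∀ n, D n = a n * D (n + 1) + D (n + 2))
    (hp : ∀ (j : ℕ) (m : ℤ) (w : ℝ), p j = 2 * m * p (j + 1) + w → |w| < p (j + 1) →
      p (j + 2) = |w|)
    (h0 : p 0 = D 0) (h1 : p 1 = D 1) (j : ℕ) :
    ∃ n, D (n + 2) ≤ p (j + 1) ∧ p j ≤ D n := by
  have key : ∃ n, (p j = D n ∧ p (j + 1) = D (n + 1)) ∨
      ∃ k : ℤ, 0 ≤ k ∧ k + 1 ≤ a n ∧ p j = D n - k * D (n + 1) ∧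
        p (j + 1) = D n - (k + 1) * D (n + 1) := by
    induction j with
    | zero => exact ⟨0, Or.inl ⟨h0, h1⟩⟩
    | succ j ih =>
      obtain ⟨n, ⟨e1, e2⟩ | ⟨k, hk, hka, e1, e2⟩⟩ := ih
      · obtain ⟨m, hm | hm⟩ := Int.even_or_odd' (a n)
        · refine ⟨n + 1, Or.inl ⟨e2, ?_⟩⟩
          rw [hp j m (D (n + 2)), abs_of_pos (hD _)]
          · rw [e1, e2, hrec n, hm]; push_cast; ring
          · rw [e2, abs_of_pos (hD _)]; exact hanti _
        · refine ⟨n + 1, Or.inr ⟨0, le_rfl, by simpa using ha (n + 1), by simpa using e2, ?_⟩⟩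
          have hlt := hanti (n + 1)
          have hpos := hD (n + 2)
          have hw : |D (n + 2) - D (n + 1)| = D (n + 1) - D (n + 2) := by
            rw [abs_of_neg (by linarith)]; ring
          rw [hp j (m + 1) (D (n + 2) - D (n + 1)), hw]
          · push_cast; ring
          · rw [e1, e2, hrec n, hm]; push_cast; ring
          · rw [hw, e2]; linarith
      · have hpos1 := hD (n + 1)
        have hpos2 := hD (n + 2)
        have hr := hrec n
        rcases hka.lt_or_eq with hlt | heq
        · have hge : ((k : ℝ) + 2) * D (n + 1) ≤ a n * D (n + 1) := by
            refine mul_le_mul_of_nonneg_right ?_ hpos1.le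
            exact_mod_cast (by omega : k + 2 ≤ a n)
          refine ⟨n, Or.inr ⟨k + 1, by omega, by omega, ?_, ?_⟩⟩
          · rw [e2]; push_cast; ring
          · have hw : |-(D n - (k + 2) * D (n + 1))| = D n - (k + 2) * D (n + 1) := by
              rw [abs_neg, abs_of_pos (by linarith)]
            rw [hp j 1 (-(D n - (k + 2) * D (n + 1))), hw]
            · push_cast; ring
            · rw [e1, e2]; push_cast; ring
            · rw [hw, e2]; linarith
        · have hcast : (k : ℝ) + 1 = a n := by exact_mod_cast heq
          have f2 : p (j + 1) = D (n + 2) := by rw [e2, hcast]; linarith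
          have f1 : p j = D (n + 1) + D (n + 2) := by
            rw [e1, hr, ← hcast]; ring
          have hr' := hrec (n + 1)
          have hlt := hanti (n + 2)
          have hpos3 := hD (n + 3)
          obtain ⟨m, hm | hm⟩ := Int.even_or_odd' (a (n + 1))
          · refine ⟨n + 2, Or.inr ⟨0, le_rfl, by simpa using ha (n + 2), by simpa using f2, ?_⟩⟩
            have hw : |D (n + 3) - D (n + 2)| = D (n + 2) - D (n + 3) := by
              rw [abs_of_neg (by linarith)]; ring
            rw [hp j (m + 1) (D (n + 3) - D (n + 2)), hw]
            · push_cast; ring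
            · rw [f1, f2, hr', hm]; push_cast; ring
            · rw [hw, f2]; linarith
          · refine ⟨n + 2, Or.inl ⟨f2, ?_⟩⟩
            rw [hp j (m + 1) (D (n + 3)), abs_of_pos hpos3]
            · rw [f1, f2, hr', hm]; push_cast; ring
            · rw [f2, abs_of_pos hpos3]; exact hlt
  obtain ⟨n, ⟨e1, e2⟩ | ⟨k, hk, hka, e1, e2⟩⟩ := key
  · exact ⟨n, e2 ▸ (hanti (n + 1)).le, e1.le⟩
  · refine ⟨n, ?_, ?_⟩
    · have hge : ((k : ℝ) + 1) * D (n + 1) ≤ a n * D (n + 1) := by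
        refine mul_le_mul_of_nonneg_right ?_ (hD _).le
        exact_mod_cast hka
      rw [e2]; linarith [hrec n]
    · have : 0 ≤ (k : ℝ) * D (n + 1) := mul_nonneg (by exact_mod_cast hk) (hD _).le
      linarith

theorem Tmap_eq_neg {y z : ℝ} {m : ℤ} (hz : |z| < 1) (h : 1 / y = 2 * m + z) :
    Tmap y = -z := by
  have hneg : -1 / y = -(2 * m + z) := by rw [← h]; ring
  have hz' := abs_lt.1 hz
  have hceil : ⌈((-1 / y) - 1) / 2⌉ = -m := by
    rw [Int.ceil_eq_iff, hneg]
    push_cast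
    constructor <;> linarith
  rw [Tmap, hceil, hneg]
  push_cast
  ring

theorem abs_Tmap_eq {y z : ℝ} {m : ℤ} (hz : |z| < 1) (h : 1 / |y| = 2 * m + z) :
    |Tmap y| = |z| := by
  rcases abs_choice y with hy | hy
  · rw [hy] at h
    rw [Tmap_eq_neg hz h, abs_neg]
  · rw [hy] at h
    have h' : 1 / y = 2 * (-m : ℤ) + -z := by
      have : 1 / y = -(1 / -y) := by rw [div_neg, neg_neg]
      rw [this, h]; push_cast; ring
    rw [Tmap_eq_neg (by rwa [abs_neg]) h', neg_neg]

theorem irrational_Tmap {y : ℝ} (hy : Irrational y) : Irrational (Tmap y) := by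
  have h : Tmap y = -y⁻¹ - ((2 * ⌈((-1 / y) - 1) / 2⌉ : ℤ) : ℝ) := by
    rw [Tmap]; push_cast; ring
  rw [h]
  exact hy.inv.neg.sub_intCast _

theorem abs_Tmap_le_one (y : ℝ) : |Tmap y| ≤ 1 := by
  have h1 := Int.le_ceil (((-1 / y) - 1) / 2)
  have h2 := Int.ceil_lt_add_one (((-1 / y) - 1) / 2)
  rw [Tmap, abs_le]
  constructor <;> linarith

/-- The orbit of `x` under the Gauss map. -/
noncomputable def gaussOrbit (x : ℝ) : ℕ → ℝ
  | 0 => x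
  | n + 1 => Int.fract (gaussOrbit x n)⁻¹

/-- The products `x_0 ⋯ x_{n-1}` along the orbit of `x` under the Gauss map. -/
noncomputable def gaussProd (x : ℝ) (n : ℕ) : ℝ := ∏ i ∈ Finset.range n, gaussOrbit x i

theorem irrational_gaussOrbit {x : ℝ} (hirr : Irrational x) (n : ℕ) : Irrational (gaussOrbit x n) := by
  induction n with
  | zero => exact hirr
  | succ n ih => exact ih.inv.sub_intCast _

theorem gaussOrbit_mem {x : ℝ} (hx : x ∈ Set.Ioo (0 : ℝ) 1) (hirr : Irrational x)
    (n : ℕ) : gaussOrbit x n ∈ Set.Ioo (0 : ℝ) 1 := by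
  cases n with
  | zero => exact hx
  | succ n =>
    exact ⟨(Int.fract_nonneg _).lt_of_ne' (irrational_gaussOrbit hirr (n + 1)).ne_zero,
      Int.fract_lt_one _⟩

theorem one_le_floor_inv_gaussOrbit {x : ℝ} (hx : x ∈ Set.Ioo (0 : ℝ) 1) (hirr : Irrational x)
    (n : ℕ) : 1 ≤ ⌊(gaussOrbit x n)⁻¹⌋ := by
  have h := gaussOrbit_mem hx hirr n
  rw [Int.le_floor]
  exact_mod_cast (one_lt_inv₀ h.1).2 h.2 |>.le

theorem gaussProd_pos {x : ℝ} (hx : x ∈ Set.Ioo (0 : ℝ) 1) (hirr : Irrational x)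
    (n : ℕ) : 0 < gaussProd x n :=
  Finset.prod_pos fun i _ => (gaussOrbit_mem hx hirr i).1

theorem gaussProd_succ_lt {x : ℝ} (hx : x ∈ Set.Ioo (0 : ℝ) 1) (hirr : Irrational x)
    (n : ℕ) : gaussProd x (n + 1) < gaussProd x n := by
  rw [gaussProd, Finset.prod_range_succ]
  exact mul_lt_of_lt_one_right (gaussProd_pos hx hirr n) (gaussOrbit_mem hx hirr n).2

theorem gaussProd_recurrence {x : ℝ} (hx : x ∈ Set.Ioo (0 : ℝ) 1) (hirr : Irrational x)
    (n : ℕ) :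
    gaussProd x n = ⌊(gaussOrbit x n)⁻¹⌋ * gaussProd x (n + 1) + gaussProd x (n + 2) := by
  have h := (gaussOrbit_mem hx hirr n).1.ne'
  have hf : gaussOrbit x (n + 1) = (gaussOrbit x n)⁻¹ - ⌊(gaussOrbit x n)⁻¹⌋ := rfl
  simp only [gaussProd, Finset.prod_range_succ]
  rw [hf]
  field_simp
  ring

theorem intFractPair_stream {x : ℝ} (hx : x ∈ Set.Ioo (0 : ℝ) 1) (hirr : Irrational x)
    (n : ℕ) :
    ∃ b, GenContFract.IntFractPair.stream x n = some ⟨b, gaussOrbit x n⟩ := by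
  induction n with
  | zero =>
    refine ⟨⌊x⌋, ?_⟩
    rw [GenContFract.IntFractPair.stream_zero, GenContFract.IntFractPair.of,
      Int.fract_eq_self.2 ⟨hx.1.le, hx.2⟩, gaussOrbit]
  | succ n ih =>
    obtain ⟨b, hb⟩ := ih
    exact ⟨_, GenContFract.IntFractPair.stream_succ_of_some hb
      (gaussOrbit_mem hx hirr n).1.ne'⟩

theorem of_s_get_eq {x : ℝ} (hx : x ∈ Set.Ioo (0 : ℝ) 1) (hirr : Irrational x)
    (n : ℕ) :
    (GenContFract.of x).s.get? n = some ⟨1, ((⌊(gaussOrbit x n)⁻¹⌋ : ℤ) : ℝ)⟩ := by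
  obtain ⟨b, hb⟩ := intFractPair_stream hx hirr n
  exact GenContFract.get?_of_eq_some_of_succ_get?_intFractPair_stream
    (GenContFract.IntFractPair.stream_succ_of_some hb (gaussOrbit_mem hx hirr n).1.ne')

theorem Qden_zero {x : ℝ} : Qden x 0 = 1 := GenContFract.zeroth_den_eq_one

theorem Qden_one {x : ℝ} (hx : x ∈ Set.Ioo (0 : ℝ) 1) (hirr : Irrational x)
    : Qden x 1 = ⌊(gaussOrbit x 0)⁻¹⌋ :=
  GenContFract.first_den_eq (of_s_get_eq hx hirr 0)

theorem Qden_succ_succ {x : ℝ} (hx : x ∈ Set.Ioo (0 : ℝ) 1) (hirr : Irrational x)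
    (n : ℕ) :
    Qden x (n + 2) = ⌊(gaussOrbit x (n + 1))⁻¹⌋ * Qden x (n + 1) + Qden x n := by
  have h := GenContFract.dens_recurrence (of_s_get_eq hx hirr (n + 1)) rfl rfl
  simpa [Qden] using h

theorem one_le_Qden_le {x : ℝ} (hx : x ∈ Set.Ioo (0 : ℝ) 1) (hirr : Irrational x)
    (n : ℕ) : 1 ≤ Qden x n ∧ Qden x n ≤ Qden x (n + 1) := by
  induction n with
  | zero =>
    rw [Qden_zero, Qden_one hx hirr]
    exact ⟨le_rfl, by exact_mod_cast one_le_floor_inv_gaussOrbit hx hirr 0⟩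
  | succ n ih =>
    have ha : (1 : ℝ) ≤ ⌊(gaussOrbit x (n + 1))⁻¹⌋ := by
      exact_mod_cast one_le_floor_inv_gaussOrbit hx hirr (n + 1)
    refine ⟨ih.1.trans ih.2, ?_⟩
    rw [Qden_succ_succ hx hirr]
    nlinarith

theorem two_le_Qden {x : ℝ} (hx : x ∈ Set.Ioo (0 : ℝ) 1) (hirr : Irrational x)
    (n : ℕ) : 2 ≤ Qden x (n + 2) := by
  have ha : (1 : ℝ) ≤ ⌊(gaussOrbit x (n + 1))⁻¹⌋ := by
    exact_mod_cast one_le_floor_inv_gaussOrbit hx hirr (n + 1)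
  have h1 := (one_le_Qden_le hx hirr n).1
  have h2 := (one_le_Qden_le hx hirr (n + 1)).1
  rw [Qden_succ_succ hx hirr]
  nlinarith

theorem Qden_mul_gaussProd {x : ℝ} (hx : x ∈ Set.Ioo (0 : ℝ) 1) (hirr : Irrational x)
    (n : ℕ) :
    Qden x (n + 1) * gaussProd x (n + 1) + Qden x n * gaussProd x (n + 2) = 1 := by
  induction n with
  | zero =>
    have h := gaussProd_recurrence hx hirr 0
    have h0 : gaussProd x 0 = 1 := by simp [gaussProd]
    rw [Qden_zero, Qden_one hx hirr, one_mul, ← h, h0]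
  | succ n ih =>
    have h := gaussProd_recurrence hx hirr (n + 1)
    rw [Qden_succ_succ hx hirr, ← ih, h]
    ring

theorem gaussProd_le_inv_Qden {x : ℝ} (hx : x ∈ Set.Ioo (0 : ℝ) 1) (hirr : Irrational x)
    (n : ℕ) : gaussProd x n ≤ (Qden x n)⁻¹ := by
  have hQ := one_le_Qden_le hx hirr n
  rw [← one_div, le_div_iff₀ (by linarith), mul_comm]
  cases n with
  | zero => simp [Qden_zero, gaussProd]
  | succ n =>
    have h := Qden_mul_gaussProd hx hirr n
    have hpos := mul_nonneg (zero_le_one.trans (one_le_Qden_le hx hirr n).1)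
      (gaussProd_pos hx hirr (n + 2)).le
    linarith

theorem neg_log_gaussProd_le {x : ℝ} (hx : x ∈ Set.Ioo (0 : ℝ) 1) (hirr : Irrational x)
    (n : ℕ) :
    -Real.log (gaussProd x (n + 2)) ≤ 2 * Real.log (Qden x (n + 2)) := by
  have h := Qden_mul_gaussProd hx hirr (n + 1)
  have hQ := one_le_Qden_le hx hirr (n + 1)
  have h2 := two_le_Qden hx hirr n
  have hlt := gaussProd_succ_lt hx hirr (n + 2)
  have hp2 := gaussProd_pos hx hirr (n + 2)
  have hp3 := gaussProd_pos hx hirr (n + 3)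
  have hge : 1 ≤ Qden x (n + 2) ^ 2 * gaussProd x (n + 2) := by
    have e1 : Qden x (n + 1) * gaussProd x (n + 3) ≤ Qden x (n + 2) * gaussProd x (n + 2) :=
      mul_le_mul hQ.2 hlt.le hp3.le (by linarith)
    have e2 := mul_le_mul_of_nonneg_right h2 (mul_nonneg (by linarith : 0 ≤ Qden x (n + 2)) hp2.le)
    have h' : Qden x (n + 2) * gaussProd x (n + 2) + Qden x (n + 1) * gaussProd x (n + 3) = 1 := h
    nlinarith
  have hlog := Real.log_nonneg hge
  rw [Real.log_mul (by positivity) hp2.ne', Real.log_pow] at hlog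
  push_cast at hlog
  linarith

/-- convergence of `Σ (Π|T^ℓx|)^α log(1/|T^j x|)` under condition (condlog). -/
theorem stmt14 (α : ℝ) (hα : 0 ≤ α)
    (x : ℝ) (hx : x ∈ Set.Ioo (0 : ℝ) 1) (hirr : Irrational x)
    (hsum : Summable (fun n : ℕ =>
      Real.log (Qden x (n + 2)) / Qden x n ^ α
        + Qden x (n + 2) * Real.log (Qden x (n + 2)) ^ 2 / Qden x (n + 1) ^ (1 + α))) :
    Summable (fun j : ℕ =>
      (∏ ℓ ∈ Finset.range j, |Tmap^[ℓ] x|) ^ α * Real.log (1 / |Tmap^[j] x|)) := by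
  have hy : ∀ j, Irrational (Tmap^[j] x) := fun j => by
    induction j with
    | zero => exact hirr
    | succ j ih => rw [Function.iterate_succ_apply']; exact irrational_Tmap ih
  have hypos : ∀ j, 0 < |Tmap^[j] x| := fun j => abs_pos.2 (hy j).ne_zero
  have hyle : ∀ j, |Tmap^[j] x| ≤ 1 := fun j => by
    cases j with
    | zero => simpa using abs_le.2 ⟨by linarith [hx.1], hx.2.le⟩
    | succ j => rw [Function.iterate_succ_apply']; exact abs_Tmap_le_one _
  set p : ℕ → ℝ := fun j => ∏ ℓ ∈ Finset.range j, |Tmap^[ℓ] x| with hpdef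
  have hppos : ∀ j, 0 < p j := fun j => Finset.prod_pos fun i _ => hypos i
  have hpsucc : ∀ j, p (j + 1) = p j * |Tmap^[j] x| := fun j => Finset.prod_range_succ _ _
  have hprec : ∀ (j : ℕ) (m : ℤ) (w : ℝ), p j = 2 * m * p (j + 1) + w → |w| < p (j + 1) →
      p (j + 2) = |w| := by
    intro j m w h hw
    have hz : |w / p (j + 1)| < 1 := by
      rwa [abs_div, abs_of_pos (hppos (j + 1)), div_lt_one (hppos _)]
    have hT : |Tmap (Tmap^[j] x)| = |w / p (j + 1)| := by
      refine abs_Tmap_eq (m := m) hz ?_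
      have e : 1 / |Tmap^[j] x| = p j / p (j + 1) := by
        rw [hpsucc]
        have := (hppos j).ne'
        have := (hypos j).ne'
        field_simp
      have := (hppos (j + 1)).ne'
      rw [e, h]
      field_simp
    rw [hpsucc (j + 1), Function.iterate_succ_apply', hT, abs_div, abs_of_pos (hppos (j + 1)),
      mul_div_cancel₀ _ (hppos (j + 1)).ne']
  have hlog : ∀ j, Real.log (1 / |Tmap^[j] x|) = -Real.log (p (j + 1)) - -Real.log (p j) := by
    intro j
    rw [hpsucc, Real.log_mul (hppos j).ne' (hypos j).ne', one_div, Real.log_inv]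
    ring
  have hlognn : ∀ j, 0 ≤ Real.log (1 / |Tmap^[j] x|) := fun j =>
    Real.log_nonneg ((one_le_div (hypos j)).2 (hyle j))
  have hD := gaussProd_pos hx hirr
  have hanti := gaussProd_succ_lt hx hirr
  have hDle : ∀ n, gaussProd x n ≤ 1 := fun n =>
    Finset.prod_le_one (fun i _ => (gaussOrbit_mem hx hirr i).1.le)
      fun i _ => (gaussOrbit_mem hx hirr i).2.le
  refine summable_of_increment_windows (c := fun n => gaussProd x n ^ α)
    (u := fun n => -Real.log (gaussProd x n)) (v := fun n => -Real.log (gaussProd x (n + 2)))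
    (l := fun j => -Real.log (p j)) (fun n => (Real.rpow_pos_of_pos (hD n) α).le)
    (fun n => neg_le_neg (Real.log_le_log (hD _) ((hanti _).trans (hanti n)).le))
    (monotone_nat_of_le_succ fun j => by linarith [hlog j, hlognn j])
    (fun j => mul_nonneg (Real.rpow_nonneg (hppos j).le _) (hlognn j)) ?_ ?_
  · intro j
    obtain ⟨n, h1, h2⟩ := even_remainders_interlace (p := p) hD hanti
      (one_le_floor_inv_gaussOrbit hx hirr) (gaussProd_recurrence hx hirr) hprec
      (by simp [hpdef, gaussProd]) (by simp [hpdef, gaussProd, gaussOrbit, abs_of_pos hx.1]) j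
    refine ⟨n, neg_le_neg (Real.log_le_log (hppos j) h2),
      neg_le_neg (Real.log_le_log (hD _) h1), ?_⟩
    rw [← hlog]
    exact mul_le_mul_of_nonneg_right (Real.rpow_le_rpow (hppos j).le h2 hα) (hlognn j)
  · refine Summable.of_nonneg_of_le (fun n => ?_) (fun n => ?_) (hsum.mul_left 2)
    · have := Real.log_le_log (hD _) ((hanti _).trans (hanti n)).le
      exact mul_nonneg (Real.rpow_nonneg (hD n).le _) (by linarith)
    · have hQ0 := (one_le_Qden_le hx hirr n).1
      have hQ1 := (one_le_Qden_le hx hirr (n + 1)).1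
      have hQ2 := two_le_Qden hx hirr n
      have hpow : gaussProd x n ^ α ≤ (Qden x n ^ α)⁻¹ := by
        rw [← Real.inv_rpow (by linarith)]
        exact Real.rpow_le_rpow (hD n).le (gaussProd_le_inv_Qden hx hirr n) hα
      have hlq : -Real.log (gaussProd x (n + 2)) - -Real.log (gaussProd x n) ≤
          2 * Real.log (Qden x (n + 2)) := by
        linarith [neg_log_gaussProd_le hx hirr n, Real.log_nonpos (hD n).le (hDle n)]
      have hlq0 : 0 ≤ Real.log (Qden x (n + 2)) := Real.log_nonneg (by linarith)
      have hsecond : 0 ≤ Qden x (n + 2) * Real.log (Qden x (n + 2)) ^ 2 /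
          Qden x (n + 1) ^ (1 + α) := by positivity
      calc _ ≤ gaussProd x n ^ α * (2 * Real.log (Qden x (n + 2))) :=
            mul_le_mul_of_nonneg_left hlq (Real.rpow_nonneg (hD n).le _)
        _ ≤ (Qden x n ^ α)⁻¹ * (2 * Real.log (Qden x (n + 2))) :=
            mul_le_mul_of_nonneg_right hpow (by linarith)
        _ = 2 * (Real.log (Qden x (n + 2)) / Qden x n ^ α) := by ring
        _ ≤ _ := by linarith
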